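/- Let n ≥ 1 and d be integers with |d| ≥ 2; set d_0 = gcd(n, |d|) and n_1 = n/d_0. Then: (i) the kernel of the endomorphism g ↦ d·g of Σ(n,d) is isomorphic to (ℤ/|d|)^{n−n_1}; (ii) if d_0 > 1, the kernel of the endomorphism g ↦ d·g of S(n,d) is isomorphic to ℤ/(|d|/d_0) ⊕ (ℤ/|d|)^{n−n_1−1}, while if d_0 = 1 this kernel is trivial. -/

import Mathlib

open Finset

noncomputable section

/-- The ring `ℤ[x]/(x^n - 1)`, realized as the group algebra `ℤ[ℤ/n]`;
the class of `x^j` (for `j : ℤ`) corresponds to `xp n (j : ZMod n)`. -/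
abbrev Rn (n : ℕ) : Type := AddMonoidAlgebra ℤ (ZMod n)

/-- The class of `x^w` in `ℤ[x]/(x^n - 1)`. -/
def xp (n : ℕ) (w : ZMod n) : Rn n := AddMonoidAlgebra.single w 1

/-- `e_v = x^v - 1`. -/
def eV (n : ℕ) (w : ZMod n) : Rn n := xp n w - 1

/-- `ε_v = d·e_v - e_{d·v}`. -/
def epsV (n : ℕ) (d : ℤ) (w : ZMod n) : Rn n := d • eV n w - eV n ((d : ZMod n) * w)

/-- `𝒵_n`, the ℤ-span of the `e_v`, `1 ≤ v ≤ n-1`. -/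
def ZSpan (n : ℕ) : Submodule ℤ (Rn n) :=
  Submodule.span ℤ {a : Rn n | ∃ v : ℤ, 1 ≤ v ∧ v ≤ (n : ℤ) - 1 ∧ a = eV n (v : ZMod n)}

/-- `ℰ_{n,d}`, the ℤ-span of the `ε_v`, `1 ≤ v ≤ n-1`. -/
def ESpan (n : ℕ) (d : ℤ) : Submodule ℤ (Rn n) :=
  Submodule.span ℤ {a : Rn n | ∃ v : ℤ, 1 ≤ v ∧ v ≤ (n : ℤ) - 1 ∧ a = epsV n d (v : ZMod n)}

/-- `1 + x + ⋯ + x^{|d|-1}`. -/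
def geomT (n : ℕ) (d : ℤ) : Rn n := ∑ i ∈ Finset.range d.natAbs, xp n (i : ZMod n)

/-- `f_v`: the Laplacian row polynomial of `DB(n,d)` (for `d ≥ 0`) resp. of
`Ktz(n,|d|)` (for `d < 0`). -/
def fV (n : ℕ) (d : ℤ) (v : ℤ) : Rn n :=
  if 0 ≤ d then d • xp n ((v : ZMod n)) - xp n (((d * v : ℤ) : ZMod n)) * geomT n d
  else d • xp n ((v : ZMod n)) + xp n (((d * (v + 1) : ℤ) : ZMod n)) * geomT n d

/-- `F_{n,d}`, the ℤ-span of the `f_v`, `1 ≤ v ≤ n-1`. -/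
def FSpan (n : ℕ) (d : ℤ) : Submodule ℤ (Rn n) :=
  Submodule.span ℤ {a : Rn n | ∃ v : ℤ, 1 ≤ v ∧ v ≤ (n : ℤ) - 1 ∧ a = fV n d v}

/-- The sand dune group `Σ(n,d) = 𝒵_n / ℰ_{n,d}`. -/
abbrev SandDune (n : ℕ) (d : ℤ) :=
  ZSpan n ⧸ Submodule.comap (ZSpan n).subtype (ESpan n d)

/-- The sandpile (critical) group `S(n,d) = 𝒵_n / F_{n,d}`. -/
abbrev Sandpile (n : ℕ) (d : ℤ) :=
  ZSpan n ⧸ Submodule.comap (ZSpan n).subtype (FSpan n d)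

/-- The elements `x^w` form a `ℤ`-basis of `ℤ[x]/(x^n - 1)`. -/
def xpBasis (n : ℕ) : Module.Basis (ZMod n) ℤ (Rn n) :=
  AddMonoidAlgebra.basis (ZMod n) ℤ

lemma xpBasis_apply (n : ℕ) (w : ZMod n) : xpBasis n w = xp n w := by
  simp [xpBasis, xp]

/-- The additive map on `ℤ[x]/(x^n - 1)` with prescribed values on the powers of `x`. -/
def xpLift {n : ℕ} {N : Type*} [AddCommGroup N] (g : ZMod n → N) : Rn n →ₗ[ℤ] N :=
  (xpBasis n).constr ℤ g

@[simp]
lemma xpLift_xp {n : ℕ} {N : Type*} [AddCommGroup N] (g : ZMod n → N) (w : ZMod n) :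
    xpLift g (xp n w) = g w := by
  rw [xpLift, ← xpBasis_apply, Module.Basis.constr_basis]

lemma xp_hom_ext {n : ℕ} {N : Type*} [AddCommGroup N] {f g : Rn n →ₗ[ℤ] N}
    (h : ∀ w, f (xp n w) = g (xp n w)) : f = g :=
  (xpBasis n).ext fun w => by simpa only [xpBasis_apply] using h w

lemma mem_of_xp_mem {n : ℕ} (p : Submodule ℤ (Rn n)) (h : ∀ w, xp n w ∈ p) (x : Rn n) :
    x ∈ p := by
  have : (⊤ : Submodule ℤ (Rn n)) ≤ p := by
    rw [← (xpBasis n).span_eq, Submodule.span_le]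
    rintro _ ⟨w, rfl⟩
    rw [xpBasis_apply]
    exact h w
  exact this trivial

lemma xp_mul_xp (n : ℕ) (v w : ZMod n) : xp n v * xp n w = xp n (v + w) := by
  simp [xp, AddMonoidAlgebra.single_mul_single]

lemma xp_zero (n : ℕ) : xp n 0 = 1 := rfl

lemma eV_zero (n : ℕ) : eV n 0 = 0 := by simp [eV, xp_zero]

lemma eq_sum_xp {n : ℕ} [NeZero n] (x : Rn n) :
    x = ∑ w, (xpBasis n).repr x w • xp n w := by
  conv_lhs => rw [← (xpBasis n).sum_repr x]
  simp only [xpBasis_apply]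

/-- The augmentation `x^w ↦ 1`. -/
def aug (n : ℕ) : Rn n →ₗ[ℤ] ℤ := xpLift fun _ => 1

/-- The additive map `x^w ↦ w` to `ℤ/n`. -/
def degMod (n : ℕ) : Rn n →ₗ[ℤ] ZMod n := xpLift fun w => w

/-- The additive map `x^w ↦ x^{c·w}`. -/
def twist (n : ℕ) (c : ZMod n) : Rn n →ₗ[ℤ] Rn n := xpLift fun w => xp n (c * w)

/-- The additive map `x^w ↦ d·x^w - x^{d·w}`, whose image on `𝒵_n` is `ℰ_{n,d}`. -/
def epsMap (n : ℕ) (d : ℤ) : Rn n →ₗ[ℤ] Rn n := d • LinearMap.id - twist n d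

/-- Multiplication by `x - 1`. -/
def mulX (n : ℕ) : Rn n →ₗ[ℤ] Rn n := LinearMap.mulLeft ℤ (xp n 1 - 1)

@[simp]
lemma aug_xp (n : ℕ) (w : ZMod n) : aug n (xp n w) = 1 := xpLift_xp _ _

@[simp]
lemma degMod_xp (n : ℕ) (w : ZMod n) : degMod n (xp n w) = w := xpLift_xp _ _

@[simp]
lemma twist_xp (n : ℕ) (c w : ZMod n) : twist n c (xp n w) = xp n (c * w) := xpLift_xp _ _

lemma epsMap_apply (n : ℕ) (d : ℤ) (x : Rn n) : epsMap n d x = d • x - twist n d x := rfl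

lemma mulX_xp (n : ℕ) (w : ZMod n) : mulX n (xp n w) = xp n (w + 1) - xp n w := by
  simp [mulX, sub_mul, xp_mul_xp, add_comm]

lemma aug_mulX (n : ℕ) (x : Rn n) : aug n (mulX n x) = 0 := by
  have : aug n ∘ₗ mulX n = 0 := xp_hom_ext fun w => by simp [mulX_xp]
  exact congr($this x)

lemma degMod_mulX (n : ℕ) (x : Rn n) : degMod n (mulX n x) = (aug n x : ZMod n) := by
  have : degMod n ∘ₗ mulX n = (Algebra.linearMap ℤ (ZMod n)) ∘ₗ aug n :=
    xp_hom_ext fun w => by simp [mulX_xp]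
  exact congr($this x)

lemma degMod_epsMap (n : ℕ) (d : ℤ) (x : Rn n) : degMod n (epsMap n d x) = 0 := by
  have : degMod n ∘ₗ epsMap n d = 0 := xp_hom_ext fun w => by
    simp only [LinearMap.comp_apply, epsMap_apply, map_sub, map_smul, degMod_xp, twist_xp]
    simp
  exact congr($this x)

lemma epsMap_eV (n : ℕ) (d : ℤ) (w : ZMod n) : epsMap n d (eV n w) = epsV n d w := by
  simp [epsMap_apply, epsV, eV, ← xp_zero]

lemma eV_mem_ZSpan (n : ℕ) [NeZero n] (w : ZMod n) : eV n w ∈ ZSpan n := by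
  by_cases hw : w = 0
  · rw [hw, eV_zero]
    exact zero_mem _
  · refine Submodule.subset_span ⟨w.val, ?_, ?_, by simp⟩
    · have := ZMod.val_pos.2 hw
      omega
    · have := ZMod.val_lt w
      omega

lemma mem_ZSpan_iff {n : ℕ} [NeZero n] {x : Rn n} : x ∈ ZSpan n ↔ aug n x = 0 := by
  constructor
  · intro hx
    have : ZSpan n ≤ LinearMap.ker (aug n) := by
      refine Submodule.span_le.2 ?_
      rintro _ ⟨v, -, -, rfl⟩
      simp [eV, ← xp_zero]
    exact this hx
  · intro hx
    have : x ∈ (ZSpan n).comap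
        (LinearMap.id - (LinearMap.toSpanSingleton ℤ (Rn n) 1) ∘ₗ aug n) := by
      refine mem_of_xp_mem _ (fun w => ?_) x
      simpa [eV] using eV_mem_ZSpan n w
    simpa [hx] using this

lemma ESpan_eq_map (n : ℕ) (d : ℤ) : ESpan n d = (ZSpan n).map (epsMap n d) := by
  rw [ESpan, ZSpan, Submodule.map_span]
  congr 1
  ext a
  constructor
  · rintro ⟨v, h1, h2, rfl⟩
    exact ⟨_, ⟨v, h1, h2, rfl⟩, epsMap_eV n d v⟩
  · rintro ⟨_, ⟨v, h1, h2, rfl⟩, rfl⟩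
    exact ⟨v, h1, h2, epsMap_eV n d v⟩

lemma twist_comp (n : ℕ) (b c : ZMod n) (x : Rn n) :
    twist n b (twist n c x) = twist n (b * c) x := by
  have : twist n b ∘ₗ twist n c = twist n (b * c) := xp_hom_ext fun w => by simp [mul_assoc]
  exact congr($this x)

lemma epsMap_injective (n : ℕ) [NeZero n] {d : ℤ} (hd : 2 ≤ |d|) :
    Function.Injective (epsMap n d) := by
  rw [injective_iff_map_eq_zero]
  intro y hy
  have h1 : twist n d y = d • y := by
    rw [epsMap_apply, sub_eq_zero] at hy
    exact hy.symm
  have hpow (k : ℕ) : twist n ((d : ZMod n) ^ k) y = d ^ k • y := by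
    induction k with
    | zero =>
      have : twist n 1 = LinearMap.id := xp_hom_ext fun w => by simp
      simp [this]
    | succ k ih => rw [pow_succ, ← twist_comp, h1, map_smul, ih, smul_smul, pow_succ, mul_comm]
  obtain ⟨a, b, hab, h⟩ := Finite.exists_ne_map_eq_of_infinite fun k : ℕ => (d : ZMod n) ^ k
  have h2 : d ^ a • y = d ^ b • y := by rw [← hpow, ← hpow]; exact congr(twist n $h y)
  have h3 : d ^ a - d ^ b ≠ 0 := by
    intro h0
    have h4 := congrArg Int.natAbs (sub_eq_zero.1 h0)
    rw [Int.natAbs_pow, Int.natAbs_pow] at h4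
    have h5 : 2 ≤ d.natAbs := by rw [Int.abs_eq_natAbs] at hd; exact_mod_cast hd
    exact hab (Nat.pow_right_injective h5 h4)
  rw [← sub_eq_zero, ← sub_smul] at h2
  exact (smul_eq_zero.1 h2).resolve_left h3

lemma aug_eq_sum {n : ℕ} [NeZero n] (x : Rn n) : aug n x = ∑ w, (xpBasis n).repr x w := by
  conv_lhs => rw [eq_sum_xp x]
  simp [-zsmul_eq_mul]

lemma eq_zero_of_mulX_eq_zero {n : ℕ} [NeZero n] {x : Rn n} (h : mulX n x = 0)
    (hx : aug n x = 0) : x = 0 := by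
  have key (w : ZMod n) (y : Rn n) :
      (xpBasis n).repr (mulX n y) (w + 1) =
        (xpBasis n).repr y w - (xpBasis n).repr y (w + 1) := by
    have : (xpBasis n).coord (w + 1) ∘ₗ mulX n =
        (xpBasis n).coord w - (xpBasis n).coord (w + 1) := xp_hom_ext fun v => by
      rw [LinearMap.comp_apply, mulX_xp]
      simp only [← xpBasis_apply, map_sub, LinearMap.sub_apply,
        Module.Basis.coord_apply, Module.Basis.repr_self, Finsupp.single_apply, add_left_inj]
    exact congr($this y)
  have hstep (w : ZMod n) : (xpBasis n).repr x (w + 1) = (xpBasis n).repr x w := by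
    have := key w x
    rw [h] at this
    simp at this
    omega
  have hconst (k : ℕ) : (xpBasis n).repr x (k : ZMod n) = (xpBasis n).repr x 0 := by
    induction k with
    | zero => simp
    | succ k ih => rw [Nat.cast_succ, hstep, ih]
  have hconst' (w : ZMod n) : (xpBasis n).repr x w = (xpBasis n).repr x 0 := by
    rw [← hconst w.val, ZMod.natCast_zmod_val]
  have h0 : (xpBasis n).repr x 0 = 0 := by
    rw [aug_eq_sum, Finset.sum_congr rfl fun w _ => hconst' w] at hx
    simpa [NeZero.ne n] using hx
  rw [eq_sum_xp x]
  simp [hconst', h0]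

lemma ZSpan_eq_span_sub (n : ℕ) [NeZero n] : ZSpan n = Submodule.span ℤ
    {a : Rn n | ∃ v : ℤ, 1 ≤ v ∧ v ≤ (n : ℤ) - 1 ∧ a = mulX n (xp n (v : ZMod n))} := by
  apply le_antisymm
  · refine Submodule.span_le.2 ?_
    rintro _ ⟨v, h1, h2, rfl⟩
    obtain ⟨k, hk⟩ : ∃ k : ℕ, v = n - k := ⟨(n - v).toNat, by omega⟩
    have h3 : k + 1 ≤ n := by omega
    clear h2 h1
    subst hk
    induction k with
    | zero => simp [eV_zero]
    | succ k ih =>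
      have h4 : mulX n (xp n (((n - (k + 1 : ℕ) : ℤ)) : ZMod n)) ∈ Submodule.span ℤ
          {a : Rn n | ∃ v : ℤ, 1 ≤ v ∧ v ≤ (n : ℤ) - 1 ∧ a = mulX n (xp n (v : ZMod n))} :=
        Submodule.subset_span ⟨n - (k + 1 : ℕ), by omega, by omega, rfl⟩
      have h5 := Submodule.sub_mem _ (ih (by omega)) h4
      rw [mulX_xp] at h5
      have h6 : (((n - (k + 1 : ℕ) : ℤ)) : ZMod n) + 1 = (((n - k : ℤ)) : ZMod n) := by
        push_cast
        ring
      rw [h6] at h5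
      simpa [eV] using h5
  · refine Submodule.span_le.2 ?_
    rintro _ ⟨v, -, -, rfl⟩
    exact mem_ZSpan_iff.2 (aug_mulX _ _)

lemma mulX_xp_mul_geomT (n : ℕ) (d : ℤ) (w : ZMod n) :
    mulX n (xp n w * geomT n d) = xp n (w + d.natAbs) - xp n w := by
  have h := Finset.sum_range_sub (fun i : ℕ => xp n (w + i)) d.natAbs
  simp only [Nat.cast_zero, add_zero] at h
  rw [← h, geomT, Finset.mul_sum, map_sum]
  refine Finset.sum_congr rfl fun i _ => ?_
  rw [xp_mul_xp, mulX_xp]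
  push_cast
  rw [add_assoc]

lemma aug_xp_mul_geomT (n : ℕ) (d : ℤ) (w : ZMod n) :
    aug n (xp n w * geomT n d) = |d| := by
  simp only [geomT, Finset.mul_sum, map_sum, xp_mul_xp, aug_xp]
  simp

lemma aug_fV (n : ℕ) (d v : ℤ) : aug n (fV n d v) = 0 := by
  unfold fV
  split_ifs with h
  · rw [map_sub, aug_xp_mul_geomT, map_smul, aug_xp, abs_of_nonneg h]
    simp
  · rw [map_add, aug_xp_mul_geomT, map_smul, aug_xp, abs_of_neg (by omega)]
    simp

lemma mulX_fV (n : ℕ) (d v : ℤ) : mulX n (fV n d v) = epsMap n d (mulX n (xp n v)) := by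
  have hrhs : epsMap n d (mulX n (xp n v)) =
      d • (xp n (v + 1) - xp n v) - (xp n (d * (v + 1)) - xp n (d * v)) := by
    rw [mulX_xp, epsMap_apply, map_sub, twist_xp, twist_xp]
  rw [hrhs]
  unfold fV
  split_ifs with h
  · rw [map_sub, mulX_xp_mul_geomT, map_smul, mulX_xp]
    have h1 : ((d * v : ℤ) : ZMod n) + (d.natAbs : ZMod n) = d * (v + 1) := by
      rw [← Int.cast_natCast, Int.natAbs_of_nonneg h]
      push_cast
      ring
    rw [h1]
    push_cast
    rfl
  · rw [map_add, mulX_xp_mul_geomT, map_smul, mulX_xp]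
    have h1 : ((d * (v + 1) : ℤ) : ZMod n) + (d.natAbs : ZMod n) = d * v := by
      rw [← Int.cast_natCast, Int.ofNat_natAbs_of_nonpos (by omega)]
      push_cast
      ring
    rw [h1]
    push_cast
    abel

lemma map_mulX_FSpan (n : ℕ) [NeZero n] (d : ℤ) : (FSpan n d).map (mulX n) = ESpan n d := by
  rw [ESpan_eq_map, ZSpan_eq_span_sub, FSpan, Submodule.map_span, Submodule.map_span]
  congr 1
  ext a
  constructor
  · rintro ⟨_, ⟨v, h1, h2, rfl⟩, rfl⟩
    exact ⟨_, ⟨v, h1, h2, rfl⟩, (mulX_fV n d v).symm⟩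
  · rintro ⟨_, ⟨v, h1, h2, rfl⟩, rfl⟩
    exact ⟨_, ⟨v, h1, h2, rfl⟩, mulX_fV n d v⟩

lemma mem_FSpan_iff {n : ℕ} [NeZero n] {d : ℤ} {y : Rn n} (hy : y ∈ ZSpan n) :
    y ∈ FSpan n d ↔ mulX n y ∈ ESpan n d := by
  rw [← map_mulX_FSpan]
  refine ⟨Submodule.mem_map_of_mem, ?_⟩
  rintro ⟨z, hz, h⟩
  have hz' : aug n z = 0 := by
    have : FSpan n d ≤ LinearMap.ker (aug n) := by
      refine Submodule.span_le.2 ?_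
      rintro _ ⟨v, -, -, rfl⟩
      exact aug_fV n d v
    exact this hz
  have h1 : z - y = 0 := eq_zero_of_mulX_eq_zero (by rw [map_sub, h, sub_self])
    (by rw [map_sub, hz', mem_ZSpan_iff.1 hy, sub_self])
  rwa [← sub_eq_zero.1 h1]

lemma exists_mulX_eq {n : ℕ} [NeZero n] {x : Rn n} (hx : aug n x = 0) (hdeg : degMod n x = 0) :
    ∃ y ∈ ZSpan n, mulX n y = x := by
  have hnat (k : ℕ) : eV n k - (k : ℤ) • eV n 1 ∈ (ZSpan n).map (mulX n) := by
    induction k with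
    | zero => simp [eV_zero]
    | succ k ih =>
      have h1 : mulX n (eV n k) ∈ (ZSpan n).map (mulX n) :=
        Submodule.mem_map_of_mem (eV_mem_ZSpan n _)
      convert Submodule.add_mem _ ih h1 using 1
      have h2 : mulX n (eV n k) = eV n (k + 1) - eV n k - eV n 1 := by
        rw [eV, map_sub, mulX_xp, ← xp_zero, mulX_xp, zero_add, xp_zero]
        simp only [eV]
        abel
      rw [h2]
      push_cast
      rw [add_smul, one_smul]
      abel
  let t : Rn n →ₗ[ℤ] ℤ := xpLift fun w => (w.val : ℤ)
  have hx1 : x ∈ ((ZSpan n).map (mulX n)).comap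
      (LinearMap.id - (LinearMap.toSpanSingleton ℤ (Rn n) 1) ∘ₗ aug n -
        (LinearMap.toSpanSingleton ℤ (Rn n) (eV n 1)) ∘ₗ t) := by
    refine mem_of_xp_mem _ (fun w => ?_) x
    have := hnat w.val
    rw [ZMod.natCast_zmod_val] at this
    rw [Submodule.mem_comap]
    simpa only [LinearMap.sub_apply, LinearMap.id_apply, LinearMap.comp_apply, aug_xp, t, eV,
      LinearMap.toSpanSingleton_apply, xpLift_xp, one_smul] using this
  have ht : ((t x : ℤ) : ZMod n) = degMod n x := by
    have : (Algebra.linearMap ℤ (ZMod n)) ∘ₗ t = degMod n := xp_hom_ext fun w => by simp [t]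
    exact congr($this x)
  rw [hdeg, ZMod.intCast_zmod_eq_zero_iff_dvd] at ht
  obtain ⟨s, hs⟩ := ht
  rw [Submodule.mem_comap] at hx1
  simp only [LinearMap.sub_apply, LinearMap.id_apply, LinearMap.comp_apply, hx,
    LinearMap.toSpanSingleton_apply, zero_smul, sub_zero, hs] at hx1
  have h3 := hnat n
  rw [ZMod.natCast_self, eV_zero, zero_sub, neg_mem_iff] at h3
  have h4 := Submodule.add_mem _ hx1 (Submodule.smul_mem _ s h3)
  rw [smul_smul, mul_comm s, sub_add_cancel] at h4
  exact h4

/-- Integer combinations of the elements `x^{n₁+i} - x^{i mod n₁}`, `0 ≤ i < k`. When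
`n = n₁ + k` and `n ∣ d·n₁`, these generate the kernel of `x^w ↦ x^{d·w}`. -/
def kerMap (n n₁ k : ℕ) : (Fin k → ℤ) →ₗ[ℤ] Rn n :=
  Fintype.linearCombination ℤ fun i : Fin k =>
    xp n ((n₁ + i : ℕ) : ZMod n) - xp n ((i % n₁ : ℕ) : ZMod n)

lemma kerMap_apply (n n₁ k : ℕ) (a : Fin k → ℤ) : kerMap n n₁ k a =
    ∑ i : Fin k, a i • (xp n ((n₁ + i : ℕ) : ZMod n) - xp n ((i % n₁ : ℕ) : ZMod n)) := rfl

lemma kerMap_single (n n₁ k : ℕ) (i : Fin k) : kerMap n n₁ k (Pi.single i 1) =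
    xp n ((n₁ + i : ℕ) : ZMod n) - xp n ((i % n₁ : ℕ) : ZMod n) := by
  simp [kerMap]

lemma aug_kerMap (n n₁ k : ℕ) (a : Fin k → ℤ) : aug n (kerMap n n₁ k a) = 0 := by
  simp only [kerMap_apply, map_sum, map_smul, map_sub, aug_xp]
  simp

lemma twist_kerMap {n n₁ k : ℕ} {c : ZMod n} (h : c * n₁ = 0) (a : Fin k → ℤ) :
    twist n c (kerMap n n₁ k a) = 0 := by
  simp only [kerMap_apply, map_sum, map_smul, map_sub, twist_xp]
  refine Finset.sum_eq_zero fun i _ => ?_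
  have h1 : c * ((n₁ + i : ℕ) : ZMod n) = c * ((i % n₁ : ℕ) : ZMod n) := by
    conv_lhs => rw [← Nat.mod_add_div i n₁]
    push_cast
    linear_combination (1 + ((i / n₁ : ℕ) : ZMod n)) * h
  rw [h1, sub_self, smul_zero]

lemma degMod_kerMap (n n₁ k : ℕ) (a : Fin k → ℤ) :
    degMod n (kerMap n n₁ k a) =
      ((n₁ * ∑ i : Fin k, a i * (1 + (i / n₁ : ℕ)) : ℤ) : ZMod n) := by
  simp only [kerMap_apply, map_sum, map_smul, map_sub, degMod_xp, Finset.mul_sum, Int.cast_sum]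
  refine Finset.sum_congr rfl fun i _ => ?_
  have h1 : ((n₁ + i : ℕ) : ZMod n) - ((i % n₁ : ℕ) : ZMod n) =
      n₁ * (1 + (i / n₁ : ℕ)) := by
    have h2 := congrArg (Nat.cast : ℕ → ZMod n) (Nat.mod_add_div i n₁)
    push_cast at h2 ⊢
    linear_combination -h2
  rw [h1, zsmul_eq_mul]
  simp only [Int.cast_mul, Int.cast_add, Int.cast_natCast, Int.cast_one]
  ring

lemma natCast_inj_of_lt {n a b : ℕ} (ha : a < n) (hb : b < n) :
    (a : ZMod n) = b ↔ a = b := by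
  rw [ZMod.natCast_eq_natCast_iff', Nat.mod_eq_of_lt ha, Nat.mod_eq_of_lt hb]

lemma repr_kerMap {n n₁ k : ℕ} (h₁ : 0 < n₁) (hk : n = n₁ + k) (a : Fin k → ℤ) (i : Fin k) :
    (xpBasis n).repr (kerMap n n₁ k a) ((n₁ + i : ℕ) : ZMod n) = a i := by
  simp only [kerMap_apply, map_sum, map_smul, map_sub, ← xpBasis_apply, Module.Basis.repr_self,
    Finsupp.finsetSum_apply, Finsupp.smul_apply, Finsupp.sub_apply, Finsupp.single_apply]
  rw [Finset.sum_eq_single i]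
  · have h1 : ¬ ((i % n₁ : ℕ) : ZMod n) = ((n₁ + i : ℕ) : ZMod n) := by
      have := Nat.mod_lt i h₁
      rw [natCast_inj_of_lt (by omega) (by omega)]
      omega
    rw [if_pos rfl, if_neg h1]
    simp
  · intro j _ hj
    have h1 : ¬ ((j % n₁ : ℕ) : ZMod n) = ((n₁ + i : ℕ) : ZMod n) := by
      have := Nat.mod_lt j h₁
      rw [natCast_inj_of_lt (by omega) (by omega)]
      omega
    have h2 : ¬ ((n₁ + j : ℕ) : ZMod n) = ((n₁ + i : ℕ) : ZMod n) := by
      rw [natCast_inj_of_lt (by omega) (by omega)]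
      intro h
      exact hj (Fin.ext (by omega))
    rw [if_neg h1, if_neg h2]
    simp
  · simp

lemma exists_eq_kerMap_add {n n₁ k : ℕ} [NeZero n] (h₁ : 0 < n₁) (hk : n = n₁ + k) (x : Rn n) :
    ∃ (a : Fin k → ℤ) (c : Fin n₁ → ℤ), x = kerMap n n₁ k a + ∑ r, c r • xp n (r : ℕ) := by
  let L : (Fin n₁ → ℤ) →ₗ[ℤ] Rn n := Fintype.linearCombination ℤ fun r => xp n (r : ℕ)
  have hL (r : ℕ) (hr : r < n₁) : xp n (r : ZMod n) ∈ LinearMap.range L :=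
    ⟨Pi.single ⟨r, hr⟩ 1, by simp [L]⟩
  have hx : x ∈ LinearMap.range (kerMap n n₁ k) ⊔ LinearMap.range L := by
    refine mem_of_xp_mem _ (fun w => ?_) x
    have hw := ZMod.val_lt w
    rw [← ZMod.natCast_zmod_val w]
    generalize w.val = v at hw
    by_cases hv : v < n₁
    · exact Submodule.mem_sup_right (hL v hv)
    · obtain ⟨i, rfl⟩ := Nat.exists_eq_add_of_le (not_lt.1 hv)
      rw [← sub_add_cancel (xp n ((n₁ + i : ℕ) : ZMod n)) (xp n ((i % n₁ : ℕ) : ZMod n))]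
      exact Submodule.add_mem_sup ⟨_, kerMap_single n n₁ k ⟨i, by omega⟩⟩
        (hL _ (Nat.mod_lt _ h₁))
  obtain ⟨_, ⟨a, rfl⟩, _, ⟨c, rfl⟩, h⟩ := Submodule.mem_sup.1 hx
  exact ⟨a, c, h.symm⟩

lemma mem_ESpan_iff {n : ℕ} [NeZero n] {d : ℤ} {x : Rn n} :
    x ∈ ESpan n d ↔ ∃ y, aug n y = 0 ∧ epsMap n d y = x := by
  simp only [ESpan_eq_map, Submodule.mem_map, mem_ZSpan_iff]

lemma epsMap_kerMap {n n₁ k : ℕ} {d : ℤ} (h : (d : ZMod n) * n₁ = 0) (a : Fin k → ℤ) :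
    epsMap n d (kerMap n n₁ k a) = d • kerMap n n₁ k a := by
  rw [epsMap_apply, twist_kerMap h, sub_zero]

lemma smul_kerMap_mem {n n₁ k : ℕ} [NeZero n] {d : ℤ} (h : (d : ZMod n) * n₁ = 0)
    (a : Fin k → ℤ) : d • kerMap n n₁ k a ∈ ESpan n d :=
  mem_ESpan_iff.2 ⟨_, aug_kerMap n n₁ k a, epsMap_kerMap h a⟩

lemma kerMap_mem_ESpan_iff {n n₁ k : ℕ} [NeZero n] {d : ℤ} (hd : 2 ≤ |d|) (h₁ : 0 < n₁)
    (hk : n = n₁ + k) (h : (d : ZMod n) * n₁ = 0) (a : Fin k → ℤ) :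
    kerMap n n₁ k a ∈ ESpan n d ↔ ∀ i, d ∣ a i := by
  rw [mem_ESpan_iff]
  constructor
  · rintro ⟨y, -, hy⟩ i
    have h1 : d • y = kerMap n n₁ k a := by
      apply epsMap_injective n hd
      rw [map_smul, hy, epsMap_kerMap h]
    rw [← repr_kerMap h₁ hk a i, ← h1]
    exact ⟨(xpBasis n).repr y ((n₁ + i : ℕ) : ZMod n), by simp [-zsmul_eq_mul]⟩
  · intro hi
    choose b hb using hi
    refine ⟨kerMap n n₁ k b, aug_kerMap _ _ _ _, ?_⟩
    rw [epsMap_kerMap h, ← map_smul]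
    congr 1
    ext i
    simp [hb]

lemma exists_sub_kerMap_mem {n n₁ k d₀ : ℕ} [NeZero n] {d e : ℤ} (hd : 2 ≤ |d|) (h₁ : 0 < n₁)
    (hk : n = n₁ + k) (hn : n₁ * d₀ = n) (he : d = d₀ * e) (hco : IsCoprime (n₁ : ℤ) e)
    (h : (d : ZMod n) * n₁ = 0) {x : Rn n} (hx : d • x ∈ ESpan n d) :
    ∃ a, x - kerMap n n₁ k a ∈ ESpan n d := by
  have hd0 : d ≠ 0 := by rintro rfl; simp at hd
  have hd₀ : (d₀ : ℤ) ≠ 0 := by rintro h0; simp [h0] at he; exact hd0 he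
  obtain ⟨y, hy, hyx⟩ := mem_ESpan_iff.1 hx
  obtain ⟨a, c, hac⟩ := exists_eq_kerMap_add h₁ hk y
  have htw : d • (y - x) = ∑ r, c r • xp n (d * (r : ℕ)) := by
    have h1 : twist n d y = d • (y - x) := by
      rw [smul_sub, ← hyx, epsMap_apply]
      abel
    rw [← h1, hac, map_add, twist_kerMap h, zero_add, map_sum]
    simp only [map_smul, twist_xp]
  have hinj (r s : Fin n₁) (hrs : (d : ZMod n) * (r : ℕ) = d * (s : ℕ)) : r = s := by
    have h1 : ((d * ((r : ℕ) - (s : ℕ)) : ℤ) : ZMod n) = 0 := by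
      push_cast
      rw [mul_sub, hrs, sub_self]
    rw [ZMod.intCast_zmod_eq_zero_iff_dvd, he, ← hn, mul_assoc] at h1
    push_cast at h1
    rw [mul_comm (n₁ : ℤ), mul_dvd_mul_iff_left hd₀] at h1
    have h2 := hco.dvd_of_dvd_mul_left h1
    have h3 := Int.eq_zero_of_abs_lt_dvd h2 (by rw [abs_lt]; omega)
    exact Fin.ext (by omega)
  have hdvd (r : Fin n₁) : d ∣ c r := by
    have h1 := congr((xpBasis n).repr $htw (d * (r : ℕ)))
    simp only [map_sum, map_smul, ← xpBasis_apply, Module.Basis.repr_self,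
      Finsupp.finsetSum_apply, Finsupp.smul_apply, Finsupp.single_apply] at h1
    rw [Finset.sum_eq_single r (fun s _ hs => by
      rw [if_neg fun h2 => hs (hinj _ _ h2), smul_zero]) (by simp), if_pos rfl] at h1
    exact ⟨_, by simpa using h1.symm⟩
  choose c' hc' using hdvd
  set z := ∑ r, c' r • xp n ((r : ℕ) : ZMod n) with hz
  have hyz : y = kerMap n n₁ k a + d • z := by
    rw [hac, hz, Finset.smul_sum]
    simp only [smul_smul, hc']
  have hzx : twist n d z = y - x := by
    have h1 : d • (twist n d z - (y - x)) = 0 := by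
      rw [smul_sub, htw, sub_eq_zero, hz, map_sum, Finset.smul_sum]
      simp only [map_smul, twist_xp, smul_smul, hc']
    exact sub_eq_zero.1 ((smul_eq_zero.1 h1).resolve_left hd0)
  refine ⟨a, mem_ESpan_iff.2 ⟨z, ?_, ?_⟩⟩
  · have h1 := hy
    rw [hyz, map_add, aug_kerMap, zero_add, map_smul] at h1
    exact (smul_eq_zero.1 h1).resolve_left hd0
  · rw [epsMap_apply, hzx]
    nth_rw 1 [← sub_eq_zero]
    rw [hyz]
    abel

lemma nonempty_addEquiv_of_range_eq_of_ker_eq {A B C Q : Type*} [AddCommGroup A] [AddCommGroup B]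
    [AddCommGroup C] [AddCommGroup Q] (h : B →+ Q) (hh : Function.Injective h) (f : A →+ Q)
    (g : A →+ C) (hg : Function.Surjective g) (hr : f.range = h.range) (hk : f.ker = g.ker) :
    Nonempty (B ≃+ C) :=
  ⟨(AddMonoidHom.ofInjective hh).trans <| (AddEquiv.addSubgroupCongr hr.symm).trans <|
    (QuotientAddGroup.quotientKerEquivRange f).symm.trans <|
      (QuotientAddGroup.quotientAddEquivOfEq hk).trans <|
        QuotientAddGroup.quotientKerEquivOfSurjective g hg⟩

lemma nonempty_ker_zsmul_addEquiv {n : ℕ} {d : ℤ} {A C : Type*} [AddCommGroup A]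
    [AddCommGroup C] (U : Submodule ℤ (Rn n)) (μ : Rn n →ₗ[ℤ] Rn n)
    (hU : ∀ x ∈ ZSpan n, x ∈ U ↔ μ x ∈ ESpan n d) (f : A →+ Rn n) (g : A →+ C)
    (hg : Function.Surjective g)
    (hf : ∀ a, ∃ x ∈ ZSpan n, d • x ∈ U ∧ f a - μ x ∈ ESpan n d)
    (hf' : ∀ x ∈ ZSpan n, d • x ∈ U → ∃ a, μ x - f a ∈ ESpan n d)
    (hk : ∀ a, f a ∈ ESpan n d ↔ g a = 0) :
    Nonempty ((zsmulAddGroupHom d : (ZSpan n ⧸ U.comap (ZSpan n).subtype) →+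
      (ZSpan n ⧸ U.comap (ZSpan n).subtype)).ker ≃+ C) := by
  let h : (ZSpan n ⧸ U.comap (ZSpan n).subtype) →ₗ[ℤ] Rn n ⧸ ESpan n d :=
    Submodule.mapQ _ _ (μ ∘ₗ (ZSpan n).subtype) fun x hx => (hU x x.2).1 hx
  have hh : Function.Injective h := by
    rw [injective_iff_map_eq_zero]
    intro q hq
    obtain ⟨x, rfl⟩ := Submodule.mkQ_surjective _ q
    exact (Submodule.Quotient.mk_eq_zero _).2
      ((hU x x.2).2 ((Submodule.Quotient.mk_eq_zero _).1 hq))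
  have hker (x : ZSpan n) : (U.comap (ZSpan n).subtype).mkQ x ∈ (zsmulAddGroupHom d :
      (ZSpan n ⧸ U.comap (ZSpan n).subtype) →+ (ZSpan n ⧸ U.comap (ZSpan n).subtype)).ker ↔
      d • (x : Rn n) ∈ U := by
    rw [AddMonoidHom.mem_ker, zsmulAddGroupHom_apply, ← map_zsmul, Submodule.mkQ_apply,
      Submodule.Quotient.mk_eq_zero]
    rfl
  refine nonempty_addEquiv_of_range_eq_of_ker_eq
    (h.toAddMonoidHom.comp (AddSubgroup.subtype _)) (hh.comp Subtype.val_injective)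
    ((ESpan n d).mkQ.toAddMonoidHom.comp f) g hg ?_ ?_
  · ext q
    constructor
    · rintro ⟨a, rfl⟩
      obtain ⟨x, hx, hdx, hax⟩ := hf a
      exact ⟨⟨_, (hker ⟨x, hx⟩).2 hdx⟩, ((Submodule.Quotient.eq _).2 hax).symm⟩
    · rintro ⟨⟨q, hq⟩, rfl⟩
      obtain ⟨x, rfl⟩ := Submodule.mkQ_surjective _ q
      obtain ⟨a, ha⟩ := hf' x x.2 ((hker x).1 hq)
      exact ⟨a, ((Submodule.Quotient.eq _).2 ha).symm⟩
  · ext a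
    rw [AddMonoidHom.mem_ker, AddMonoidHom.mem_ker, ← hk]
    exact Submodule.Quotient.mk_eq_zero _

/-- Coordinatewise reduction `ℤ^ι → (ℤ/m)^ι`. -/
def castPi (m : ℕ) (ι : Type*) : (ι → ℤ) →+ (ι → ZMod m) :=
  (Int.castAddHom (ZMod m)).compLeft ι

lemma castPi_surjective (m : ℕ) (ι : Type*) : Function.Surjective (castPi m ι) :=
  (ZMod.intCast_surjective (n := m)).comp_left

lemma castPi_eq_zero_iff (d : ℤ) (ι : Type*) (a : ι → ℤ) :
    castPi d.natAbs ι a = 0 ↔ ∀ i, d ∣ a i := by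
  rw [funext_iff]
  refine forall_congr' fun i => ?_
  rw [← Int.natAbs_dvd (a := d), ← ZMod.intCast_zmod_eq_zero_iff_dvd]
  rfl

/-- The map `(s, q) ↦ (d₀·s - ∑ᵢ qᵢ·cᵢ, q)`, with image `{b | d₀ ∣ b₀ + ∑ᵢ bᵢ₊₁·cᵢ}`. -/
def consMap (d₀ : ℤ) {k : ℕ} (c : Fin k → ℤ) : ℤ × (Fin k → ℤ) →+ (Fin (k + 1) → ℤ) where
  toFun p := Fin.cons (d₀ * p.1 - ∑ i, p.2 i * c i) p.2
  map_zero' := by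
    ext i
    refine Fin.cases ?_ (fun j => ?_) i <;> simp
  map_add' p q := by
    ext i
    refine Fin.cases ?_ (fun j => ?_) i
    · simp only [Prod.fst_add, Prod.snd_add, Pi.add_apply, Fin.cons_zero, add_mul,
        Finset.sum_add_distrib]
      ring
    · simp

lemma consMap_apply (d₀ : ℤ) {k : ℕ} (c : Fin k → ℤ) (p : ℤ × (Fin k → ℤ)) :
    consMap d₀ c p = Fin.cons (d₀ * p.1 - ∑ i, p.2 i * c i) p.2 := rfl

lemma dvd_consMap_iff {d₀ e : ℤ} (hd₀ : d₀ ≠ 0) {k : ℕ} (c : Fin k → ℤ) (p : ℤ × (Fin k → ℤ)) :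
    (∀ i, d₀ * e ∣ consMap d₀ c p i) ↔ e ∣ p.1 ∧ ∀ i, d₀ * e ∣ p.2 i := by
  simp only [consMap_apply, Fin.forall_fin_succ, Fin.cons_zero, Fin.cons_succ]
  refine and_congr_left fun h => ?_
  rw [dvd_sub_left (Finset.dvd_sum fun i _ => (h i).mul_right _), mul_dvd_mul_iff_left hd₀]

/-- with `d₀ = gcd(n, |d|)` and `n₁ = n/d₀`: (i) the kernel of
`g ↦ d·g` on `Σ(n,d)` is isomorphic to `(ℤ/|d|)^{n−n₁}`; (ii) if `d₀ > 1`, the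
kernel of `g ↦ d·g` on `S(n,d)` is isomorphic to
`ℤ/(|d|/d₀) ⊕ (ℤ/|d|)^{n−n₁−1}`, while if `d₀ = 1` this kernel is trivial. -/
theorem stmt8 (n : ℕ) (d : ℤ) (hn : 1 ≤ n) (hd : 2 ≤ |d|) :
    Nonempty ((zsmulAddGroupHom d : SandDune n d →+ SandDune n d).ker ≃+
      (Fin (n - n / Nat.gcd n d.natAbs) → ZMod d.natAbs)) ∧
    (1 < Nat.gcd n d.natAbs →
      Nonempty ((zsmulAddGroupHom d : Sandpile n d →+ Sandpile n d).ker ≃+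
        ZMod (d.natAbs / Nat.gcd n d.natAbs) ×
          (Fin (n - n / Nat.gcd n d.natAbs - 1) → ZMod d.natAbs))) ∧
    (Nat.gcd n d.natAbs = 1 →
      Subsingleton (zsmulAddGroupHom d : Sandpile n d →+ Sandpile n d).ker) := by
  have : NeZero n := ⟨by omega⟩
  have hd₀pos : 0 < n.gcd d.natAbs := Nat.gcd_pos_of_pos_left _ hn
  have hco' : Nat.Coprime (n / n.gcd d.natAbs) (d.natAbs / n.gcd d.natAbs) :=
    Nat.coprime_div_gcd_div_gcd hd₀pos
  have hn' : n / n.gcd d.natAbs * n.gcd d.natAbs = n := Nat.div_mul_cancel (Nat.gcd_dvd_left _ _)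
  have hd' : n.gcd d.natAbs * (d.natAbs / n.gcd d.natAbs) = d.natAbs :=
    Nat.mul_div_cancel' (Nat.gcd_dvd_right _ _)
  generalize n.gcd d.natAbs = d₀ at *
  generalize n / d₀ = n₁ at *
  have h₁ : 0 < n₁ := Nat.pos_of_ne_zero fun h => by simp [h] at hn'; omega
  obtain ⟨e, he⟩ : (d₀ : ℤ) ∣ d := Int.natCast_dvd.2 ⟨_, hd'.symm⟩
  have hde : d.natAbs / d₀ = e.natAbs := by
    rw [he, Int.natAbs_mul, Int.natAbs_natCast, Nat.mul_div_cancel_left _ hd₀pos]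
  have hco : IsCoprime (n₁ : ℤ) e := by
    rw [Int.isCoprime_iff_gcd_eq_one, Int.gcd, Int.natAbs_natCast, ← hde]
    exact hco'
  have hle : n₁ ≤ n := by rw [← hn']; exact Nat.le_mul_of_pos_right _ hd₀pos
  obtain ⟨k, hk⟩ := Nat.exists_eq_add_of_le hle
  have hnk : n - n₁ = k := by omega
  rw [hnk, hde]
  have h : (d : ZMod n) * n₁ = 0 := by
    rw [← Int.cast_natCast n₁, ← Int.cast_mul, ZMod.intCast_zmod_eq_zero_iff_dvd]
    refine ⟨e, ?_⟩
    rw [he, ← hn']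
    push_cast
    ring
  refine ⟨?_, fun hlt => ?_, fun h1 => ?_⟩
  · refine nonempty_ker_zsmul_addEquiv (ESpan n d) LinearMap.id (fun _ _ => Iff.rfl)
      (kerMap n n₁ k).toAddMonoidHom (castPi d.natAbs (Fin k)) (castPi_surjective _ _) ?_ ?_ ?_
    · exact fun a => ⟨_, mem_ZSpan_iff.2 (aug_kerMap n n₁ k a), smul_kerMap_mem h a, by simp⟩
    · exact fun x _ hx => exists_sub_kerMap_mem hd h₁ hk hn' he hco h hx
    · exact fun a => (kerMap_mem_ESpan_iff hd h₁ hk h a).trans (castPi_eq_zero_iff d _ a).symm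
  · obtain ⟨k, rfl⟩ : ∃ j, k = j + 1 := by
      refine Nat.exists_eq_add_one.2 ?_
      nlinarith
    have hd₀ : (d₀ : ℤ) ≠ 0 := by omega
    let c : Fin k → ℤ := fun i => 1 + (((i : ℕ) + 1) / n₁ : ℕ)
    have hc (a : Fin (k + 1) → ℤ) :
        degMod n (kerMap n n₁ (k + 1) a) = 0 ↔ (d₀ : ℤ) ∣ a 0 + ∑ i, a i.succ * c i := by
      rw [degMod_kerMap, ZMod.intCast_zmod_eq_zero_iff_dvd, Fin.sum_univ_succ, ← hn',
        Nat.cast_mul, mul_dvd_mul_iff_left (by omega)]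
      simp [c]
    refine nonempty_ker_zsmul_addEquiv (FSpan n d) (mulX n) (fun x hx => mem_FSpan_iff hx)
      ((kerMap n n₁ (k + 1)).toAddMonoidHom.comp (consMap d₀ c))
      ((Int.castAddHom (ZMod e.natAbs)).prodMap (castPi d.natAbs (Fin k))) ?_ ?_ ?_ ?_
    · exact ZMod.intCast_surjective.prodMap (castPi_surjective _ _)
    · intro p
      obtain ⟨y, hy, hyp⟩ := exists_mulX_eq (aug_kerMap n n₁ (k + 1) (consMap d₀ c p))
        ((hc _).2 (by simp [consMap_apply]))
      refine ⟨y, hy, ?_, ?_⟩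
      · rw [mem_FSpan_iff (Submodule.smul_mem _ _ hy), map_smul, hyp]
        exact smul_kerMap_mem h _
      · rw [hyp]
        simp
    · intro x hx hdx
      rw [mem_FSpan_iff (Submodule.smul_mem _ _ hx), map_smul] at hdx
      obtain ⟨a, ha⟩ := exists_sub_kerMap_mem hd h₁ hk hn' he hco h hdx
      have hdeg : degMod n (kerMap n n₁ (k + 1) a) = 0 := by
        obtain ⟨y, -, hy⟩ := mem_ESpan_iff.1 ha
        have h2 := degMod_epsMap n d y
        rw [hy, map_sub, degMod_mulX, mem_ZSpan_iff.1 hx] at h2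
        simpa using h2
      obtain ⟨s, hs⟩ := (hc a).1 hdeg
      refine ⟨(s, Fin.tail a), ?_⟩
      have h3 : consMap d₀ c (s, Fin.tail a) = a := by
        rw [consMap_apply, ← hs]
        simp only [Fin.tail, add_sub_cancel_right]
        exact Fin.cons_self_tail a
      simpa [h3] using ha
    · intro p
      refine (kerMap_mem_ESpan_iff hd h₁ hk h _).trans ?_
      rw [AddMonoidHom.prodMap_def, Prod.ext_iff]
      refine (show _ ↔ _ from ?_ : (∀ i, d ∣ consMap d₀ c p i) ↔
        (((p.1 : ℤ) : ZMod e.natAbs) = 0 ∧ castPi d.natAbs (Fin k) p.2 = 0))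
      rw [castPi_eq_zero_iff, ZMod.intCast_zmod_eq_zero_iff_dvd, Int.natAbs_dvd, he]
      exact dvd_consMap_iff hd₀ c p
  · obtain rfl : k = 0 := by
      rw [h1] at hn'
      omega
    obtain ⟨E⟩ := nonempty_ker_zsmul_addEquiv (d := d) (A := Unit) (C := Unit) (FSpan n d)
      (mulX n) (fun x hx => mem_FSpan_iff hx) 0 0 (fun _ => ⟨0, rfl⟩)
      (fun _ => ⟨0, zero_mem _, by simp, by simp⟩)
      (fun x hx hdx => by
        rw [mem_FSpan_iff (Submodule.smul_mem _ _ hx), map_smul] at hdx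
        obtain ⟨a, ha⟩ := exists_sub_kerMap_mem hd h₁ hk hn' he hco h hdx
        refine ⟨0, ?_⟩
        simpa [kerMap_apply] using ha)
      (fun _ => by simp)
    exact E.toEquiv.subsingleton
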